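/- Assume the number of voters n ≥ 3 is odd and let D be a connected domain with D_C ⊊ D. An SDS on D is strategyproof and non-imposing if and only if it is a random dictatorship. -/

import Mathlib

open scoped Classical
open Finset

/-- A preference relation: a complete, transitive, and antisymmetric binary relation. -/
def IsPref {A : Type*} (r : A → A → Prop) : Prop :=
  (∀ x y : A, x ≠ y → r x y ∨ r y x) ∧
  (∀ x y z : A, r x y → r y z → r x z) ∧
  (∀ x y : A, r x y → ¬ r y x)

/-- A preference profile for `n` voters over alternatives `A`. -/
abbrev Prof (n : ℕ) (A : Type*) := Fin n → A → A → Prop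

/-- Every voter's relation is a preference relation. -/
def IsProf {n : ℕ} {A : Type*} (R : Prof n A) : Prop := ∀ i, IsPref (R i)

/-- The majority margin `g_R(x,y)`. -/
noncomputable def margin {n : ℕ} {A : Type*} (R : Prof n A) (x y : A) : ℤ :=
  (Nat.card {i : Fin n // R i x y} : ℤ) - (Nat.card {i : Fin n // R i y x} : ℤ)

/-- `x` is the Condorcet winner of `R`. -/
def CondorcetWinner {n : ℕ} {A : Type*} (R : Prof n A) (x : A) : Prop :=
  ∀ y, y ≠ x → 0 < margin R x y

/-- The Condorcet domain: all profiles admitting a Condorcet winner. -/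
def CondorcetDomain (n : ℕ) (A : Type*) : Set (Prof n A) :=
  {R | IsProf R ∧ ∃ x, CondorcetWinner R x}

/-- The `(n+1)`-voter profile `(R, ▷)` obtained from `R` by adding `t` as an extra voter. -/
def tieProf {n : ℕ} {A : Type*} (R : Prof n A) (t : A → A → Prop) : Prof (n + 1) A :=
  Fin.cons t R

/-- The tie-breaking Condorcet domain `D_C^▷`. -/
def TieCondorcetDomain (n : ℕ) {A : Type*} (t : A → A → Prop) : Set (Prof n A) :=
  {R | IsProf R ∧ ∃ x, CondorcetWinner (tieProf R t) x}

/-- Upper contour set `U(≻, x)`. -/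
def UC {A : Type*} (r : A → A → Prop) (x : A) : Set A := {y | r y x ∨ y = x}

/-- Probability that the lottery `p` assigns to the set `S`. -/
noncomputable def mass {A : Type*} [Fintype A] (p : A → ℝ) (S : Set A) : ℝ :=
  ∑ y, S.indicator p y

/-- Stochastic dominance `p ≿^SD q` w.r.t. the preference relation `r`. -/
def SDdom {A : Type*} [Fintype A] (r : A → A → Prop) (p q : A → ℝ) : Prop :=
  ∀ x, mass q (UC r x) ≤ mass p (UC r x)

/-- `f` is a social decision scheme on the domain `D`: on `D` it returns lotteries. -/
def IsSDS {n : ℕ} {A : Type*} [Fintype A] (D : Set (Prof n A))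
    (f : Prof n A → A → ℝ) : Prop :=
  ∀ R ∈ D, (∀ x, 0 ≤ f R x) ∧ (∑ x, f R x) = 1

/-- Strategyproofness of `f` on `D`. -/
def Strategyproof {n : ℕ} {A : Type*} [Fintype A] (D : Set (Prof n A))
    (f : Prof n A → A → ℝ) : Prop :=
  ∀ R ∈ D, ∀ R' ∈ D, ∀ i : Fin n,
    (∀ j, j ≠ i → R j = R' j) → SDdom (R i) (f R) (f R')

/-- Group-strategyproofness of `f` on `D`. -/
def GroupStrategyproof {n : ℕ} {A : Type*} [Fintype A] (D : Set (Prof n A))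
    (f : Prof n A → A → ℝ) : Prop :=
  ∀ R ∈ D, ∀ R' ∈ D, ∀ I : Finset (Fin n), I.Nonempty →
    (∀ j ∉ I, R j = R' j) → ∃ i ∈ I, SDdom (R i) (f R) (f R')

/-- Non-imposition of `f` on `D`. -/
def NonImposing {n : ℕ} {A : Type*} [Fintype A] (D : Set (Prof n A))
    (f : Prof n A → A → ℝ) : Prop :=
  ∀ x : A, ∃ R ∈ D, f R x = 1

/-- Ex post efficiency of `f` on `D`. -/
def ExPostEfficient {n : ℕ} {A : Type*} [Fintype A] (D : Set (Prof n A))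
    (f : Prof n A → A → ℝ) : Prop :=
  ∀ R ∈ D, ∀ x y : A, (∀ i, R i x y) → f R y = 0

/-- `x` is top-ranked by the preference relation `r`. -/
def TopRanked {A : Type*} (r : A → A → Prop) (x : A) : Prop := ∀ y, y ≠ x → r x y

/-- The dictatorship of voter `i`. -/
noncomputable def dict {n : ℕ} {A : Type*} [Fintype A] (i : Fin n) (R : Prof n A) : A → ℝ :=
  fun x => if TopRanked (R i) x then 1 else 0

/-- The Condorcet rule `COND`. -/
noncomputable def CondRule {n : ℕ} {A : Type*} [Fintype A] : Prof n A → A → ℝ :=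
  fun R x => if CondorcetWinner R x then 1 else 0

/-- The tie-breaking Condorcet rule `COND^▷`. -/
noncomputable def TieCondRule {n : ℕ} {A : Type*} [Fintype A] (t : A → A → Prop) :
    Prof n A → A → ℝ :=
  fun R x => if CondorcetWinner (tieProf R t) x then 1 else 0

/-- The relation obtained from `r` by swapping the (adjacent) alternatives `x ≻ y`. -/
def swapRel {A : Type*} (r : A → A → Prop) (x y : A) : A → A → Prop :=
  fun a b => (a = y ∧ b = x) ∨ (r a b ∧ ¬(a = x ∧ b = y))

/-- `R'` arises from `R` by letting voter `i` swap the adjacent alternatives `x ≻_i y`,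
i.e., `R' = R^{i:yx}`. -/
def AdjSwap {n : ℕ} {A : Type*} (R R' : Prof n A) (i : Fin n) (x y : A) : Prop :=
  x ≠ y ∧ R i x y ∧ (∀ z, z ≠ x → z ≠ y → ¬(R i x z ∧ R i z y)) ∧
  R' i = swapRel (R i) x y ∧ (∀ j, j ≠ i → R' j = R j)

/-- A single ad-path step inside `D`. -/
def Step {n : ℕ} {A : Type*} (D : Set (Prof n A)) (R R' : Prof n A) : Prop :=
  R ∈ D ∧ R' ∈ D ∧ ∃ i x y, AdjSwap R R' i x y

/-- A single ad-path step inside `D` in which the alternative `a` is not swapped. -/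
def StepAvoiding {n : ℕ} {A : Type*} (D : Set (Prof n A)) (a : A) (R R' : Prof n A) : Prop :=
  R ∈ D ∧ R' ∈ D ∧ ∃ i x y, AdjSwap R R' i x y ∧ x ≠ a ∧ y ≠ a

/-- There is an ad-path from `R` to `R'` inside `D`. -/
def AdPath {n : ℕ} {A : Type*} (D : Set (Prof n A)) (R R' : Prof n A) : Prop :=
  R ∈ D ∧ R' ∈ D ∧ Relation.ReflTransGen (Step D) R R'

/-- There is an ad-path from `R` to `R'` inside `D` along which `a` is never swapped. -/
def AdPathAvoiding {n : ℕ} {A : Type*} (D : Set (Prof n A)) (a : A) (R R' : Prof n A) : Prop :=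
  R ∈ D ∧ R' ∈ D ∧ Relation.ReflTransGen (StepAvoiding D a) R R'

/-- `D` is weakly connected. -/
def WeaklyConnected {n : ℕ} {A : Type*} (D : Set (Prof n A)) : Prop :=
  ∀ R ∈ D, ∀ R' ∈ D, AdPath D R R'

/-- `D` is connected. -/
def Connected {n : ℕ} {A : Type*} (D : Set (Prof n A)) : Prop :=
  WeaklyConnected D ∧
  ∀ a : A, ∀ R ∈ D, ∀ R' ∈ D, (∀ i, UC (R i) a = UC (R' i) a) → AdPathAvoiding D a R R'

section Preferences

variable {A : Type*}

lemma IsPref.irrefl {r : A → A → Prop} (h : IsPref r) (x : A) : ¬ r x x :=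
  fun hx => h.2.2 x x hx hx

lemma self_mem_UC (r : A → A → Prop) (x : A) : x ∈ UC r x := Or.inr rfl

lemma IsPref.UC_upper {r : A → A → Prop} (h : IsPref r) {x a b : A} (ha : a ∈ UC r x)
    (hb : r b a) : b ∈ UC r x := by
  rcases ha with ha | rfl
  · exact Or.inl (h.2.1 _ _ _ hb ha)
  · exact Or.inl hb

lemma IsPref.UC_diff_upper {r : A → A → Prop} (h : IsPref r) {x a b : A}
    (ha : a ∈ UC r x \ {x}) (hb : r b a) : b ∈ UC r x \ {x} := by
  have hax : r a x := ha.1.resolve_right ha.2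
  refine ⟨Or.inl (h.2.1 _ _ _ hb hax), ?_⟩
  rintro rfl
  exact h.2.2 _ _ hb hax

lemma mem_UC_of_ne {r : A → A → Prop} {x y : A} (hxy : y ≠ x) :
    y ∈ UC r x ↔ r y x := by
  simp [UC, hxy]

lemma IsPref.notMem_UC_iff {r : A → A → Prop} (h : IsPref r) {x y : A} (hxy : y ≠ x) :
    y ∉ UC r x ↔ r x y := by
  rw [mem_UC_of_ne hxy]
  exact ⟨fun hn => (h.1 x y hxy.symm).resolve_right hn, fun hr => h.2.2 _ _ hr⟩

lemma IsPref.UC_eq_singleton_iff {r : A → A → Prop} (h : IsPref r) {x : A} :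
    UC r x = {x} ↔ TopRanked r x := by
  constructor
  · intro hU y hy
    rw [← h.notMem_UC_iff hy, hU]
    simpa using hy
  · intro ht
    ext y
    by_cases hy : y = x
    · simp [hy, self_mem_UC]
    · simpa [hy] using (h.notMem_UC_iff hy).2 (ht y hy)

lemma IsPref.topRanked_unique {r : A → A → Prop} (h : IsPref r) {x y : A}
    (hx : TopRanked r x) (hy : TopRanked r y) : x = y := by
  by_contra hne
  exact h.2.2 _ _ (hx y (Ne.symm hne)) (hy x hne)

/-- A nonempty upper set of a preference relation on a finite type is an upper contour set. -/
lemma IsPref.exists_UC_eq [Finite A] {r : A → A → Prop} (h : IsPref r) {S : Set A}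
    (hne : S.Nonempty) (hS : ∀ a ∈ S, ∀ b, r b a → b ∈ S) : ∃ y, UC r y = S := by
  have : IsTrans A (fun a b => r b a) := ⟨fun a b c hab hbc => h.2.1 _ _ _ hbc hab⟩
  have : Std.Irrefl (fun a b : A => r b a) := ⟨fun a => h.irrefl a⟩
  have hwf : WellFounded (fun a b : A => r b a) := Finite.wellFounded_of_trans_of_irrefl _
  obtain ⟨y, hy, hmin⟩ := hwf.has_min S hne
  refine ⟨y, Set.ext fun a => ⟨?_, fun ha => ?_⟩⟩
  · rintro (ha | rfl)
    · exact hS y hy a ha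
    · exact hy
  · by_cases hay : a = y
    · exact Or.inr hay
    · exact Or.inl ((h.1 a y hay).resolve_right (hmin a ha))

lemma IsPref.exists_topRanked [Finite A] [Nonempty A] {r : A → A → Prop} (h : IsPref r) :
    ∃ x, TopRanked r x := by
  have : IsTrans A r := ⟨fun a b c hab hbc => h.2.1 _ _ _ hab hbc⟩
  have : Std.Irrefl r := ⟨fun a => h.irrefl a⟩
  have hwf : WellFounded r := Finite.wellFounded_of_trans_of_irrefl _
  obtain ⟨y, -, hmin⟩ := hwf.has_min Set.univ Set.univ_nonempty
  exact ⟨y, fun a ha => (h.1 y a ha.symm).resolve_right (hmin a trivial)⟩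

lemma UC_swapRel {r : A → A → Prop} {a b x : A} (ha : a ≠ x) (hb : b ≠ x) :
    UC (swapRel r a b) x = UC r x := by
  ext y
  simp only [UC, swapRel, Set.mem_ofPred_eq]
  grind

/-- The preference relation induced by a key (smaller is better), ties broken by a fixed
enumeration of the alternatives. -/
noncomputable def keyRel [Fintype A] (k : A → ℕ) : A → A → Prop :=
  fun a b => k a < k b ∨ (k a = k b ∧ Fintype.equivFin A a < Fintype.equivFin A b)

lemma isPref_keyRel [Fintype A] (k : A → ℕ) : IsPref (keyRel k) := by
  refine ⟨fun x y hxy => ?_, fun x y z hxy hyz => ?_, fun x y hxy hyx => ?_⟩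
  · have hne : Fintype.equivFin A x ≠ Fintype.equivFin A y :=
      fun h => hxy ((Fintype.equivFin A).injective h)
    unfold keyRel
    rcases lt_trichotomy (k x) (k y) with h | h | h
    · exact Or.inl (Or.inl h)
    · rcases lt_or_gt_of_ne hne with h' | h'
      · exact Or.inl (Or.inr ⟨h, h'⟩)
      · exact Or.inr (Or.inr ⟨h.symm, h'⟩)
    · exact Or.inr (Or.inl h)
  · unfold keyRel at *
    rcases hxy with h | ⟨h, h'⟩ <;> rcases hyz with h2 | ⟨h2, h2'⟩
    · exact Or.inl (h.trans h2)
    · exact Or.inl (h2 ▸ h)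
    · exact Or.inl (h ▸ h2)
    · exact Or.inr ⟨h.trans h2, h'.trans h2'⟩
  · unfold keyRel at *
    rcases hxy with h | ⟨h, h'⟩ <;> rcases hyx with h2 | ⟨h2, h2'⟩
    · omega
    · omega
    · omega
    · exact lt_asymm h' h2'

lemma keyRel_of_lt [Fintype A] {k : A → ℕ} {a b : A} (h : k a < k b) : keyRel k a b := Or.inl h

lemma mem_UC_keyRel [Fintype A] {k : A → ℕ} {x : A} (hk : ∀ a, a ≠ x → k a ≠ k x) (a : A) :
    a ∈ UC (keyRel k) x ↔ k a ≤ k x := by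
  by_cases h : a = x
  · simp [h, self_mem_UC]
  · have := hk a h
    rw [mem_UC_of_ne h, keyRel]
    omega

/-- A key placing `x` directly below `U`, the alternatives in `U ∩ W` above the rest of `U`, and
`z` as high as this allows. -/
noncomputable def contourKey (x z : A) (U W : Set A) : A → ℕ := fun a =>
  if a = x then 3
  else if a ∈ U then (if a ∈ W then (if a = z then 0 else 1) else 2)
  else if a = z then 4 else 5

lemma UC_contourKey [Fintype A] {x z : A} {U W : Set A} (hx : x ∈ U) :
    UC (keyRel (contourKey x z U W)) x = U := by
  ext a
  rw [mem_UC_keyRel]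
  · unfold contourKey
    grind
  · unfold contourKey
    grind

lemma contourKey_upper [Fintype A] {x z : A} {U W : Set A} (hWU : W ⊆ U) {a b : A}
    (ha : a ∈ W \ {x}) (hb : keyRel (contourKey x z U W) b a) : b ∈ W \ {x} := by
  have hle : contourKey x z U W b ≤ contourKey x z U W a := by
    rcases hb with hb | hb
    · exact hb.le
    · exact hb.1.le
  obtain ⟨haW, hax⟩ := ha
  have haU := hWU haW
  rw [Set.mem_singleton_iff] at hax
  by_contra hcon
  simp only [Set.mem_sdiff, Set.mem_singleton_iff, not_and, not_not] at hcon
  unfold contourKey at hle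
  grind

end Preferences

section Majorities

variable {n : ℕ} {A : Type*}

/-- A strict majority of the voters satisfies `p`. -/
def Majority (p : Fin n → Prop) : Prop := n < 2 * #{i | p i}

lemma Majority.mono {p q : Fin n → Prop} (h : Majority p) (hpq : ∀ i, p i → q i) :
    Majority q := by
  have : #{i | p i} ≤ #{i | q i} := card_le_card (monotone_filter_right _ fun i _ => hpq i)
  simp only [Majority] at *
  omega

lemma card_filter_add_card_not (p : Fin n → Prop) : #{i | p i} + #{i | ¬ p i} = n := by
  simpa using card_filter_add_card_filter_not (s := (univ : Finset (Fin n))) p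

lemma majority_or_majority_not (hodd : Odd n) (p : Fin n → Prop) :
    Majority p ∨ Majority (fun i => ¬ p i) := by
  have := card_filter_add_card_not p
  obtain ⟨k, hk⟩ := hodd
  simp only [Majority]
  omega

lemma Majority.not_not {p : Fin n → Prop} (h : Majority p) : ¬ Majority (fun i => ¬ p i) := by
  have := card_filter_add_card_not p
  simp only [Majority] at *
  omega

lemma majority_mem_iff {V : Finset (Fin n)} : Majority (fun i => i ∈ V) ↔ n < 2 * #V := by
  simp [Majority]

lemma margin_pos_iff {R : Prof n A} (hR : IsProf R) {x y : A} (hxy : y ≠ x) :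
    0 < margin R x y ↔ Majority (fun i => R i x y) := by
  have h1 := card_filter_add_card_not (fun i => R i x y)
  have h2 : ∀ i, ¬ R i x y ↔ R i y x := fun i =>
    ⟨fun h => ((hR i).1 x y hxy.symm).resolve_left h, fun h => (hR i).2.2 _ _ h⟩
  simp only [h2] at h1
  simp only [margin, Majority]
  rw [Nat.card_eq_fintype_card, Nat.card_eq_fintype_card, Fintype.card_subtype,
    Fintype.card_subtype]
  omega

lemma condorcetWinner_iff {R : Prof n A} (hR : IsProf R) {x : A} :
    CondorcetWinner R x ↔ ∀ y, y ≠ x → Majority (fun i => R i x y) :=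
  forall₂_congr fun _ hy => margin_pos_iff hR hy

lemma exists_majority_above (hodd : Odd n) {R : Prof n A} (hR : IsProf R) {x : A}
    (hx : ¬ CondorcetWinner R x) : ∃ z, z ≠ x ∧ Majority (fun i => z ∈ UC (R i) x) := by
  rw [condorcetWinner_iff hR] at hx
  push Not at hx
  obtain ⟨z, hz, hmaj⟩ := hx
  refine ⟨z, hz, ((majority_or_majority_not hodd _).resolve_left hmaj).mono fun i hi => ?_⟩
  exact Or.inl (((hR i).1 x z hz.symm).resolve_left hi)

end Majorities

section Profiles

variable {n : ℕ} {A : Type*} [Fintype A]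

/-- The profile whose relations are given by `contourKey`. -/
noncomputable def contourProf (x z : A) (U W : Fin n → Set A) : Prof n A :=
  fun i => keyRel (contourKey x z (U i) (W i))

lemma isProf_contourProf (x z : A) (U W : Fin n → Set A) : IsProf (contourProf x z U W) :=
  fun _ => isPref_keyRel _

lemma contourProf_mem_of_majority {x z : A} {U W : Fin n → Set A} (hzx : z ≠ x)
    (h : Majority (fun i => z ∈ U i ∧ z ∈ W i)) :
    contourProf x z U W ∈ CondorcetDomain n A := by
  refine ⟨isProf_contourProf _ _ _ _, z, ?_⟩
  rw [condorcetWinner_iff (isProf_contourProf _ _ _ _)]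
  refine fun y hy => h.mono fun i hi => keyRel_of_lt ?_
  unfold contourKey
  grind

lemma contourProf_mem_of_beats {x z : A} {U W : Fin n → Set A}
    (h : ∀ y, y ≠ x → Majority (fun i => y ∉ U i)) :
    contourProf x z U W ∈ CondorcetDomain n A := by
  refine ⟨isProf_contourProf _ _ _ _, x, ?_⟩
  rw [condorcetWinner_iff (isProf_contourProf _ _ _ _)]
  refine fun y hy => (h y hy).mono fun i hi => keyRel_of_lt ?_
  unfold contourKey
  grind

lemma mass_empty (p : A → ℝ) : mass p ∅ = 0 := by simp [mass]

lemma mass_insert (p : A → ℝ) {S : Set A} {x : A} (hx : x ∉ S) :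
    mass p (insert x S) = mass p S + p x := by
  have : ∀ y, (insert x S).indicator p y = S.indicator p y + if y = x then p y else 0 := by
    intro y
    simp only [Set.indicator_apply, Set.mem_insert_iff]
    by_cases h : y = x
    · subst h; simp [hx]
    · simp [h]
  simp [mass, this, sum_add_distrib]

end Profiles

section Strategyproofness

variable {n : ℕ} {A : Type*} [Fintype A]

/-- A strategyproof and non-imposing SDS on a domain containing the Condorcet domain, for which the
probability of each alternative depends only on its upper contour sets. -/
structure ContourRule (D : Set (Prof n A)) (f : Prof n A → A → ℝ) : Prop where
  isProf : ∀ R ∈ D, IsProf R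
  condorcet : CondorcetDomain n A ⊆ D
  isSDS : IsSDS D f
  strategyproof : Strategyproof D f
  nonImposing : NonImposing D f
  contour : ∀ R ∈ D, ∀ R' ∈ D, ∀ x, (∀ i, UC (R i) x = UC (R' i) x) → f R x = f R' x

lemma Strategyproof.mass_le {D : Set (Prof n A)} {f : Prof n A → A → ℝ} (h : Strategyproof D f)
    {R R' : Prof n A} (hR : R ∈ D) (hR' : R' ∈ D) {i : Fin n} (hj : ∀ j, j ≠ i → R j = R' j)
    (hi : IsPref (R i)) {S : Set A} (hS : ∀ a ∈ S, ∀ b, R i b a → b ∈ S) :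
    mass (f R') S ≤ mass (f R) S := by
  rcases S.eq_empty_or_nonempty with rfl | hne
  · simp [mass_empty]
  · obtain ⟨y, rfl⟩ := hi.exists_UC_eq hne hS
    exact h R hR R' hR' i hj y

lemma Strategyproof.apply_le {D : Set (Prof n A)} {f : Prof n A → A → ℝ} (h : Strategyproof D f)
    {R R' : Prof n A} (hR : R ∈ D) (hR' : R' ∈ D) {i : Fin n} (hj : ∀ j, j ≠ i → R j = R' j)
    (hi : IsPref (R i)) (hi' : IsPref (R' i)) {x : A}
    (hS : ∀ a ∈ UC (R' i) x \ {x}, ∀ b, R i b a → b ∈ UC (R' i) x \ {x}) :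
    f R x ≤ f R' x := by
  have h1 := h.mass_le hR hR' hj hi hS
  have h2 := h.mass_le hR' hR (fun j hne => (hj j hne).symm) hi' (S := UC (R' i) x)
    fun a ha b hb => hi'.UC_upper ha hb
  have hU : insert x (UC (R' i) x \ {x}) = UC (R' i) x := by
    rw [Set.insert_sdiff_singleton, Set.insert_eq_of_mem (self_mem_UC _ _)]
  rw [← hU, mass_insert _ (by simp), mass_insert _ (by simp)] at h2
  linarith

lemma Strategyproof.apply_eq {D : Set (Prof n A)} {f : Prof n A → A → ℝ} (h : Strategyproof D f)
    {R R' : Prof n A} (hR : R ∈ D) (hR' : R' ∈ D) {i : Fin n} (hj : ∀ j, j ≠ i → R j = R' j)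
    (hi : IsPref (R i)) (hi' : IsPref (R' i)) {x : A} (hU : UC (R i) x = UC (R' i) x) :
    f R x = f R' x := by
  apply le_antisymm
  · refine h.apply_le hR hR' hj hi hi' fun a ha b hb => ?_
    rw [← hU] at ha ⊢
    exact hi.UC_diff_upper ha hb
  · refine h.apply_le hR' hR (fun j hne => (hj j hne).symm) hi' hi fun a ha b hb => ?_
    rw [hU] at ha ⊢
    exact hi'.UC_diff_upper ha hb

lemma Strategyproof.contour {D : Set (Prof n A)} {f : Prof n A → A → ℝ}
    (h : Strategyproof D f) (hD : ∀ R ∈ D, IsProf R) (hconn : Connected D) :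
    ∀ R ∈ D, ∀ R' ∈ D, ∀ x, (∀ i, UC (R i) x = UC (R' i) x) → f R x = f R' x := by
  intro R hR R' hR' x hU
  obtain ⟨-, -, hpath⟩ := hconn.2 x R hR R' hR' hU
  clear hU hR'
  induction hpath with
  | refl => rfl
  | tail _ hstep ih =>
    obtain ⟨hP, hP', i, a, b, ⟨-, -, -, hswap, hrest⟩, ha, hb⟩ := hstep
    rw [ih]
    refine h.apply_eq hP hP' (fun j hj => (hrest j hj).symm) (hD _ hP i) (hD _ hP' i) ?_
    rw [hswap, UC_swapRel ha hb]

namespace ContourRule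

variable {D : Set (Prof n A)} {f : Prof n A → A → ℝ}

lemma nonneg (h : ContourRule D f) {R : Prof n A} (hR : R ∈ D) (x : A) : 0 ≤ f R x :=
  (h.isSDS R hR).1 x

lemma sum_eq_one (h : ContourRule D f) {R : Prof n A} (hR : R ∈ D) : ∑ x, f R x = 1 :=
  (h.isSDS R hR).2

lemma le_one (h : ContourRule D f) {R : Prof n A} (hR : R ∈ D) (x : A) : f R x ≤ 1 := by
  rw [← h.sum_eq_one hR]
  exact single_le_sum (fun y _ => h.nonneg hR y) (mem_univ x)

lemma eq_zero_of_eq_one (h : ContourRule D f) {R : Prof n A} (hR : R ∈ D) {x y : A}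
    (hxy : x ≠ y) (hy : f R y = 1) : f R x = 0 := by
  have h1 : ∑ a ∈ {x, y}, f R a ≤ ∑ a, f R a :=
    sum_le_univ_sum_of_nonneg fun a => h.nonneg hR a
  rw [sum_pair hxy, h.sum_eq_one hR] at h1
  linarith [h.nonneg hR x]

/-- Raising `x` weakly in every ranking does not decrease its probability, provided a majority
prefers a common `z` to `x` after the change, or `x` is the Condorcet winner before it. -/
lemma mono (h : ContourRule D f) {R R' : Prof n A} (hR : R ∈ D) (hR' : R' ∈ D) {x : A} (z : A)
    (hsub : ∀ i, UC (R' i) x ⊆ UC (R i) x)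
    (hmaj : (z ≠ x ∧ Majority (fun i => z ∈ UC (R' i) x)) ∨
      ∀ y, y ≠ x → Majority (fun i => y ∉ UC (R i) x)) :
    f R x ≤ f R' x := by
  let U : Finset (Fin n) → Fin n → Set A :=
    fun T i => if i ∈ T then UC (R' i) x else UC (R i) x
  let Q : Finset (Fin n) → Prof n A :=
    fun T => contourProf x z (U T) (fun i => UC (R' i) x)
  have hsubU : ∀ T i, UC (R' i) x ⊆ U T i ∧ U T i ⊆ UC (R i) x := by
    intro T i
    have := hsub i
    by_cases hi : i ∈ T <;> simp [U, hi, this]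
  have hUQ : ∀ T i, UC (Q T i) x = U T i :=
    fun T i => UC_contourKey ((hsubU T i).1 (self_mem_UC _ _))
  have hQ : ∀ T, Q T ∈ D := by
    intro T
    apply h.condorcet
    rcases hmaj with ⟨hz, hmaj⟩ | hmaj
    · exact contourProf_mem_of_majority hz (hmaj.mono fun i hi => ⟨(hsubU T i).1 hi, hi⟩)
    · exact contourProf_mem_of_beats fun y hy =>
        (hmaj y hy).mono fun i hi hyU => hi ((hsubU T i).2 hyU)
  have hle : ∀ T, f (Q ∅) x ≤ f (Q T) x := by
    intro T
    induction T using Finset.induction_on with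
    | empty => exact le_rfl
    | insert i T hi ih =>
      refine ih.trans (h.strategyproof.apply_le (hQ T) (hQ _) (i := i) ?_ (isPref_keyRel _)
        (isPref_keyRel _) ?_)
      · intro j hj
        simp [Q, contourProf, U, hj]
      · have hUi : UC (Q (insert i T) i) x = UC (R' i) x := by
          rw [hUQ]; simp [U]
        rw [hUi]
        exact fun a ha b hb => contourKey_upper (hsubU T i).1 ha hb
  have h0 : f R x = f (Q ∅) x := h.contour _ hR _ (hQ _) x fun i => by rw [hUQ]; simp [U]
  have h1 : f (Q univ) x = f R' x := h.contour _ (hQ _) _ hR' x fun i => by rw [hUQ]; simp [U]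
  rw [h0, ← h1]
  exact hle univ

end ContourRule

/-- Voters in `V` rank `x` first and `y` second, all others rank `y` first and `x` second. -/
noncomputable def pairProf (x y : A) (V : Finset (Fin n)) : Prof n A :=
  contourProf x y (fun i => if i ∈ V then {x} else {x, y}) (fun _ => Set.univ)

lemma UC_pairProf_of_mem {x y : A} {V : Finset (Fin n)} {i : Fin n} (hi : i ∈ V) :
    UC (pairProf x y V i) x = {x} := by
  rw [pairProf, contourProf, UC_contourKey] <;> simp [hi]

lemma UC_pairProf_of_notMem {x y : A} {V : Finset (Fin n)} {i : Fin n} (hi : i ∉ V) :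
    UC (pairProf x y V i) x = {x, y} := by
  rw [pairProf, contourProf, UC_contourKey] <;> simp [hi]

lemma contourProf_mem_of_finset (hodd : Odd n) {x y : A} (hxy : x ≠ y) {V : Finset (Fin n)}
    {U : Fin n → Set A} (h1 : ∀ i ∈ V, U i = {x}) (h2 : ∀ i ∉ V, y ∈ U i) :
    contourProf x y U (fun _ => Set.univ) ∈ CondorcetDomain n A := by
  rcases majority_or_majority_not hodd (fun i => i ∈ V) with hV | hV
  · exact contourProf_mem_of_beats fun w hw => hV.mono fun i hi => by simpa [h1 i hi] using hw
  · exact contourProf_mem_of_majority hxy.symm (hV.mono fun i hi => ⟨h2 i hi, trivial⟩)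

lemma pairProf_mem (hodd : Odd n) {x y : A} (hxy : x ≠ y) (V : Finset (Fin n)) :
    pairProf x y V ∈ CondorcetDomain n A :=
  contourProf_mem_of_finset hodd hxy (V := V) (by simp +contextual) (by simp +contextual)

/-- Voters in `V` rank `x` first, all others rank `y` first and `x` last. -/
noncomputable def coalitionProf (x y : A) (V : Finset (Fin n)) : Prof n A :=
  contourProf x y (fun i => if i ∈ V then {x} else Set.univ) (fun _ => Set.univ)

lemma coalitionProf_mem (hodd : Odd n) {x y : A} (hxy : x ≠ y) (V : Finset (Fin n)) :
    coalitionProf x y V ∈ CondorcetDomain n A :=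
  contourProf_mem_of_finset hodd hxy (V := V) (by simp +contextual) (by simp +contextual)

lemma UC_coalitionProf_of_mem {x y : A} {V : Finset (Fin n)} {i : Fin n} (hi : i ∈ V) :
    UC (coalitionProf x y V i) x = {x} := by
  rw [coalitionProf, contourProf, UC_contourKey] <;> simp [hi]

lemma UC_coalitionProf_of_notMem {x y : A} {V : Finset (Fin n)} {i : Fin n} (hi : i ∉ V) :
    UC (coalitionProf x y V i) x = Set.univ := by
  rw [coalitionProf, contourProf, UC_contourKey] <;> simp [hi]

lemma UC_contourKey_snd {x y : A} (hxy : x ≠ y) (U : Set A) :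
    UC (keyRel (contourKey x y U Set.univ)) y = if y ∈ U then {y} else insert x (insert y U) := by
  ext a
  rw [mem_UC_keyRel]
  · unfold contourKey
    split_ifs <;> simp_all
  · unfold contourKey
    grind

namespace ContourRule

variable {D : Set (Prof n A)} {f : Prof n A → A → ℝ}

lemma pairProf_unanimous (h : ContourRule D f) (hodd : Odd n) {x y : A} (hxy : x ≠ y)
    {V : Finset (Fin n)} (hV : f (pairProf x y V) x = 1) : f (pairProf x y univ) x = 1 := by
  have hmem := fun T : Finset (Fin n) => h.condorcet (pairProf_mem hodd hxy T)
  have key : ∀ T : Finset (Fin n), f (pairProf x y (V ∪ T)) x = 1 := by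
    intro T
    induction T using Finset.induction_on with
    | empty => simpa using hV
    | insert i T hi ih =>
      refine le_antisymm (h.le_one (hmem _) x) ?_
      rw [← ih]
      refine h.strategyproof.apply_le (hmem _) (hmem _) (i := i) ?_ (isPref_keyRel _)
        (isPref_keyRel _) ?_
      · intro j hj
        simp [pairProf, contourProf, hj]
      · rw [UC_pairProf_of_mem (by simp)]
        simp
  exact eq_univ_of_forall (s := V ∪ univ) (by simp) ▸ key univ

lemma unanimous (h : ContourRule D f) (hodd : Odd n) {R : Prof n A}
    (hR : R ∈ D) {x : A} (hx : ∀ i, TopRanked (R i) x) : f R x = 1 := by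
  obtain ⟨R₀, hR₀, hf⟩ := h.nonImposing x
  have hUR : ∀ i, UC (R i) x = {x} := fun i => ((h.isProf R hR i).UC_eq_singleton_iff).2 (hx i)
  by_cases hc : CondorcetWinner R₀ x
  · refine le_antisymm (h.le_one hR x) ?_
    rw [← hf]
    refine h.mono hR₀ hR x (fun i => ?_) (Or.inr fun y hy => ?_)
    · rw [hUR]
      simpa using self_mem_UC _ _
    · exact ((condorcetWinner_iff (h.isProf _ hR₀)).1 hc y hy).mono fun i hi =>
        ((h.isProf _ hR₀ i).notMem_UC_iff hy).2 hi
  · obtain ⟨z, hz, hmaj⟩ := exists_majority_above hodd (h.isProf _ hR₀) hc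
    let V : Finset (Fin n) := {i | z ∉ UC (R₀ i) x}
    have hV : f (pairProf x z V) x = 1 := by
      have hP := h.condorcet (pairProf_mem hodd hz.symm V)
      refine le_antisymm (h.le_one hP x) ?_
      rw [← hf]
      refine h.mono hR₀ hP z (fun i => ?_) (Or.inl ⟨hz, hmaj.mono fun i hi => ?_⟩)
      · by_cases hi : z ∈ UC (R₀ i) x
        · rw [UC_pairProf_of_notMem (by simpa [V] using hi)]
          exact Set.insert_subset (self_mem_UC _ _) (by simpa using hi)
        · rw [UC_pairProf_of_mem (by simpa [V] using hi)]
          simpa using self_mem_UC _ _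
      · rw [UC_pairProf_of_notMem (by simpa [V] using hi)]
        simp
    rw [← h.pairProf_unanimous hodd hz.symm hV]
    refine h.contour _ hR _ (h.condorcet (pairProf_mem hodd hz.symm _)) x fun i => ?_
    rw [hUR, UC_pairProf_of_mem (mem_univ i)]

lemma pareto (h : ContourRule D f) (hodd : Odd n) {R : Prof n A} (hR : R ∈ D) {x y : A}
    (hxy : x ≠ y) (hyx : ∀ i, R i y x) : f R x = 0 := by
  have hmem : ∀ i, y ∈ UC (R i) x := fun i => Or.inl (hyx i)
  have hQ := h.condorcet (contourProf_mem_of_finset hodd hxy (V := ∅)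
    (U := fun i => UC (R i) x) (by simp) (fun i _ => hmem i))
  rw [h.contour _ hR _ hQ x fun i => (UC_contourKey (self_mem_UC _ _)).symm]
  refine h.eq_zero_of_eq_one hQ hxy (h.unanimous hodd hQ fun i => ?_)
  rw [← (isProf_contourProf _ _ _ _ i).UC_eq_singleton_iff, contourProf,
    UC_contourKey_snd hxy, if_pos (hmem i)]

lemma apply_add_apply (h : ContourRule D f) (hodd : Odd n) {R : Prof n A} (hR : R ∈ D) {x y : A}
    (hxy : x ≠ y) (hw : ∀ w, w ≠ x → w ≠ y → ∀ i, R i y w) : f R x + f R y = 1 := by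
  rw [← h.sum_eq_one hR, ← sum_pair hxy]
  refine sum_subset (subset_univ _) fun w _ hw' => ?_
  simp only [mem_insert, mem_singleton, not_or] at hw'
  exact h.pareto hodd hR hw'.2 (hw w hw'.1 hw'.2)

lemma contourProf_add (h : ContourRule D f) (hodd : Odd n) {x y : A} (hxy : x ≠ y)
    {V : Finset (Fin n)} {U : Fin n → Set A} (h1 : ∀ i ∈ V, U i = {x}) (h2 : ∀ i ∉ V, y ∈ U i) :
    f (contourProf x y U fun _ => Set.univ) x + f (contourProf x y U fun _ => Set.univ) y = 1 := by
  refine h.apply_add_apply hodd (h.condorcet (contourProf_mem_of_finset hodd hxy h1 h2)) hxy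
    fun w hwx hwy i => keyRel_of_lt ?_
  by_cases hi : i ∈ V
  · simp [contourKey, h1 i hi, hxy.symm, hwx, hwy]
  · have := h2 i hi
    unfold contourKey
    grind

lemma apply_eq_pairProf (h : ContourRule D f) (hodd : Odd n) {R : Prof n A} (hR : R ∈ D)
    {x y : A} (hxy : x ≠ y) {V : Finset (Fin n)} (h1 : ∀ i ∈ V, UC (R i) x = {x})
    (h2 : ∀ i ∉ V, y ∈ UC (R i) x) : f R x = f (pairProf x y V) x := by
  have hQ := h.condorcet (contourProf_mem_of_finset hodd hxy h1 h2)
  have hP := h.condorcet (pairProf_mem hodd hxy V)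
  have hQs := h.contourProf_add hodd hxy h1 h2
  have hPs : f (pairProf x y V) x + f (pairProf x y V) y = 1 :=
    h.contourProf_add hodd hxy (V := V) (by simp +contextual) (by simp +contextual)
  rw [h.contour _ hR _ hQ x fun i => (UC_contourKey (self_mem_UC _ _)).symm]
  have hy := h.contour _ hQ _ hP y fun i => by
    rw [pairProf, contourProf, contourProf, UC_contourKey_snd hxy, UC_contourKey_snd hxy]
    by_cases hi : i ∈ V
    · simp [h1 i hi, hi]
    · simp [h2 i hi, hi]
  linarith

lemma pairProf_add (h : ContourRule D f) (hodd : Odd n) {x y : A} (hxy : x ≠ y)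
    (V : Finset (Fin n)) : f (pairProf x y V) x + f (pairProf y x Vᶜ) y = 1 := by
  have hP := h.condorcet (pairProf_mem hodd hxy V)
  have hPs : f (pairProf x y V) x + f (pairProf x y V) y = 1 :=
    h.contourProf_add hodd hxy (V := V) (by simp +contextual) (by simp +contextual)
  rw [← h.apply_eq_pairProf hodd hP hxy.symm (V := Vᶜ)]
  · exact hPs
  · intro i hi
    rw [mem_compl] at hi
    rw [pairProf, contourProf, UC_contourKey_snd hxy]
    simp [hi]
  · intro i hi
    rw [mem_compl, not_not] at hi
    rw [pairProf, contourProf, UC_contourKey_snd hxy]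
    simp [hi, hxy.symm]

lemma pairProf_right (h : ContourRule D f) (hodd : Odd n) {x y z : A} (hxy : x ≠ y)
    (hxz : x ≠ z) (V : Finset (Fin n)) : f (pairProf x y V) x = f (pairProf x z V) x := by
  have hQ := h.condorcet (coalitionProf_mem hodd hxy V)
  rw [← h.apply_eq_pairProf hodd hQ hxy, ← h.apply_eq_pairProf hodd hQ hxz]
  all_goals
    intro i hi
    simp [UC_coalitionProf_of_mem, UC_coalitionProf_of_notMem, hi]

/-- The probability of an alternative top-ranked exactly by a coalition, all other voters
preferring a common alternative, depends only on the coalition. -/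
lemma exists_coalition_prob (h : ContourRule D f) (hodd : Odd n) (hA : 3 ≤ Fintype.card A) :
    ∃ b : Finset (Fin n) → ℝ, ∀ R ∈ D, ∀ x y V, x ≠ y → (∀ i ∈ V, UC (R i) x = {x}) →
      (∀ i ∉ V, y ∈ UC (R i) x) → f R x = b V := by
  have hthird : ∀ x y : A, ∃ z, z ≠ x ∧ z ≠ y := by
    intro x y
    have : #{x, y} < #(univ : Finset A) := by
      rw [card_univ]
      exact (card_le_two).trans_lt hA
    obtain ⟨z, -, hz⟩ := exists_mem_notMem_of_card_lt_card this
    exact ⟨z, by simpa using hz⟩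
  have : Nontrivial A := Fintype.one_lt_card_iff_nontrivial.1 (by omega)
  obtain ⟨x₀, y₀, h₀⟩ := exists_pair_ne A
  refine ⟨fun V => f (pairProf x₀ y₀ V) x₀, fun R hR x y V hxy h1 h2 => ?_⟩
  rw [h.apply_eq_pairProf hodd hR hxy h1 h2]
  by_cases hx : x = x₀
  · subst hx
    exact h.pairProf_right hodd hxy h₀ V
  · obtain ⟨z, hzx, hzx₀⟩ := hthird x x₀
    have e1 := h.pairProf_right hodd hxy hzx.symm V
    have e2 := h.pairProf_right hodd h₀ hzx₀.symm V
    have e3 := h.pairProf_add hodd hzx.symm V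
    have e4 := h.pairProf_add hodd hzx₀.symm V
    have e5 := h.pairProf_right hodd hzx hzx₀ Vᶜ
    linarith

end ContourRule

end Strategyproofness

section RandomDictatorship

variable {n : ℕ} {A : Type*} [Fintype A]

/-- The key ranking `x`, `y`, `z` in this order above all other alternatives. -/
noncomputable def tripleKey (x y z : A) : A → ℕ := fun a =>
  if a = x then 0 else if a = y then 1 else if a = z then 2 else 3

lemma UC_tripleKey_fst {x y z : A} : UC (keyRel (tripleKey x y z)) x = {x} := by
  ext a
  rw [mem_UC_keyRel] <;> simp only [tripleKey] <;> grind

lemma mem_UC_tripleKey_snd {x y z : A} : x ∈ UC (keyRel (tripleKey x y z)) y := by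
  by_cases h : x = y
  · exact Or.inr h
  · exact Or.inl (keyRel_of_lt (by simp [tripleKey, Ne.symm h]))

lemma mem_UC_tripleKey_trd {x y z : A} (hyz : y ≠ z) (hxz : x ≠ z) :
    y ∈ UC (keyRel (tripleKey x y z)) z :=
  Or.inl (keyRel_of_lt (by unfold tripleKey; grind))

/-- The probability that the random dictatorship with weights `γ` assigns to `x`; the weights need
not sum up to one. -/
noncomputable def topWeight (γ : Fin n → ℝ) (R : Prof n A) (x : A) : ℝ := ∑ i, γ i * dict i R x

lemma topWeight_eq_sum_filter (γ : Fin n → ℝ) (R : Prof n A) (x : A) :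
    topWeight γ R x = ∑ i with TopRanked (R i) x, γ i := by
  simp [topWeight, dict, sum_filter]

lemma dict_eq_ite {R : Prof n A} (hR : IsProf R) {i : Fin n} {t : A} (ht : TopRanked (R i) t)
    (x : A) : dict i R x = if x = t then 1 else 0 := by
  by_cases hx : x = t
  · simp [dict, hx, ht]
  · have : ¬ TopRanked (R i) x := fun h => hx ((hR i).topRanked_unique h ht)
    simp [dict, hx, this]

lemma sum_dict [Nonempty A] {R : Prof n A} (hR : IsProf R) (i : Fin n) : ∑ x, dict i R x = 1 := by
  obtain ⟨t, ht⟩ := (hR i).exists_topRanked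
  simp [dict_eq_ite hR ht]

lemma sum_topWeight [Nonempty A] (γ : Fin n → ℝ) {R : Prof n A} (hR : IsProf R) :
    ∑ x, topWeight γ R x = ∑ i, γ i := by
  simp only [topWeight]
  rw [sum_comm]
  simp [← mul_sum, sum_dict hR]

/-- `γ` gives the probabilities of alternatives that are top-ranked by `V` and are ranked below a
common alternative by everyone else. -/
def HasWeights (D : Set (Prof n A)) (f : Prof n A → A → ℝ) (γ : Fin n → ℝ) : Prop :=
  ∀ R ∈ D, ∀ x y V, x ≠ y →
    (∀ i ∈ V, UC (R i) x = {x}) → (∀ i ∉ V, y ∈ UC (R i) x) →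
    (2 * #V < n → f R x = ∑ i ∈ V, γ i) ∧ (n < 2 * #V → f R x = 1 - ∑ i ∈ Vᶜ, γ i)

namespace ContourRule

variable {D : Set (Prof n A)} {f : Prof n A → A → ℝ}

lemma coalition_prob_add (h : ContourRule D f) (hodd : Odd n) (hA : 3 ≤ Fintype.card A)
    {b : Finset (Fin n) → ℝ}
    (hb : ∀ R ∈ D, ∀ x y V, x ≠ y → (∀ i ∈ V, UC (R i) x = {x}) →
      (∀ i ∉ V, y ∈ UC (R i) x) → f R x = b V)
    {W Z : Finset (Fin n)} (hWZ : Disjoint W Z) (hcard : 2 * #(W ∪ Z) < n) :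
    b (W ∪ Z)ᶜ + b W + b Z = 1 := by
  obtain ⟨x, y, z, hxy, hxz, hyz⟩ := Fintype.two_lt_card_iff.1 (show 2 < Fintype.card A by omega)
  let R : Prof n A := fun i =>
    if i ∈ W then keyRel (tripleKey y x z)
    else if i ∈ Z then keyRel (tripleKey z y x)
    else keyRel (tripleKey x z y)
  have hRW : ∀ i ∈ W, R i = keyRel (tripleKey y x z) := fun i hi => if_pos hi
  have hRZ : ∀ i ∈ Z, R i = keyRel (tripleKey z y x) := fun i hi => by
    simp [R, disjoint_right.1 hWZ hi, hi]
  have hRV : ∀ i, i ∉ W → i ∉ Z → R i = keyRel (tripleKey x z y) := fun i hi hi' => by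
    simp [R, hi, hi']
  have hRp : IsProf R := by
    intro i
    by_cases hW : i ∈ W
    · rw [hRW i hW]; exact isPref_keyRel _
    · by_cases hZ : i ∈ Z
      · rw [hRZ i hZ]; exact isPref_keyRel _
      · rw [hRV i hW hZ]; exact isPref_keyRel _
  have hR : R ∈ D := by
    refine h.condorcet ⟨hRp, x, (condorcetWinner_iff hRp).2 fun w hw => ?_⟩
    have hmaj : Majority (fun i => i ∈ (W ∪ Z)ᶜ) := by
      rw [majority_mem_iff, card_compl, Fintype.card_fin]
      omega
    refine hmaj.mono fun i hi => ?_
    simp only [mem_compl, mem_union, not_or] at hi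
    rw [hRV i hi.1 hi.2, ← (isPref_keyRel _).notMem_UC_iff hw, UC_tripleKey_fst]
    simpa using hw
  have hx : f R x = b (W ∪ Z)ᶜ := by
    refine hb R hR x y _ hxy (fun i hi => ?_) fun i hi => ?_
    · simp only [mem_compl, mem_union, not_or] at hi
      rw [hRV i hi.1 hi.2, UC_tripleKey_fst]
    · simp only [mem_compl, mem_union, not_not] at hi
      rcases hi with hi | hi
      · rw [hRW i hi]; exact mem_UC_tripleKey_snd
      · rw [hRZ i hi]; exact mem_UC_tripleKey_trd hxy.symm hxz.symm
  have hy : f R y = b W := by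
    refine hb R hR y z _ hyz (fun i hi => ?_) fun i hi => ?_
    · rw [hRW i hi, UC_tripleKey_fst]
    · by_cases hZ : i ∈ Z
      · rw [hRZ i hZ]; exact mem_UC_tripleKey_snd
      · rw [hRV i hi hZ]; exact mem_UC_tripleKey_trd hyz.symm hxy
  have hz : f R z = b Z := by
    refine hb R hR z x _ hxz.symm (fun i hi => ?_) fun i hi => ?_
    · rw [hRZ i hi, UC_tripleKey_fst]
    · by_cases hW : i ∈ W
      · rw [hRW i hW]; exact mem_UC_tripleKey_trd hxz hyz
      · rw [hRV i hW hi]; exact mem_UC_tripleKey_snd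
  rw [← hx, ← hy, ← hz, ← h.sum_eq_one hR]
  have hsub : ∑ a ∈ {x, y, z}, f R a = ∑ a, f R a := by
    refine sum_subset (subset_univ _) fun a _ ha => ?_
    simp only [mem_insert, mem_singleton, not_or] at ha
    refine h.pareto hodd hR ha.1 fun i => ?_
    by_cases hW : i ∈ W
    · rw [hRW i hW]; exact keyRel_of_lt (by unfold tripleKey; grind)
    · by_cases hZ : i ∈ Z
      · rw [hRZ i hZ]; exact keyRel_of_lt (by unfold tripleKey; grind)
      · rw [hRV i hW hZ]; exact keyRel_of_lt (by unfold tripleKey; grind)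
  rw [← hsub, sum_insert (by simp [hxy, hxz]), sum_pair hyz]
  ring

lemma exists_weights (h : ContourRule D f) (hn : 3 ≤ n) (hodd : Odd n)
    (hA : 3 ≤ Fintype.card A) :
    ∃ γ : Fin n → ℝ, (∀ i, 0 ≤ γ i) ∧ HasWeights D f γ := by
  obtain ⟨b, hb⟩ := h.exists_coalition_prob hodd hA
  have : Nontrivial A := Fintype.one_lt_card_iff_nontrivial.1 (by omega)
  obtain ⟨x₀, y₀, h₀⟩ := exists_pair_ne A
  have hP := fun V : Finset (Fin n) => h.condorcet (pairProf_mem hodd h₀ V)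
  have hbP : ∀ V, f (pairProf x₀ y₀ V) x₀ = b V := fun V =>
    hb _ (hP V) x₀ y₀ V h₀ (fun i hi => UC_pairProf_of_mem hi)
      fun i hi => by rw [UC_pairProf_of_notMem hi]; simp
  have hempty : b ∅ = 0 := by
    rw [← hbP]
    refine h.pareto hodd (hP ∅) h₀ fun i => ?_
    refine (mem_UC_of_ne h₀.symm).1 ?_
    rw [UC_pairProf_of_notMem (by simp)]
    simp
  have hcompl : ∀ V : Finset (Fin n), 2 * #V < n → b Vᶜ + b V = 1 := fun V hV => by
    simpa [hempty] using h.coalition_prob_add hodd hA hb (disjoint_empty_right V) (by simpa using hV)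
  have hsum : ∀ V : Finset (Fin n), 2 * #V < n → b V = ∑ i ∈ V, b {i} := by
    intro V
    induction V using Finset.induction_on with
    | empty => simp [hempty]
    | insert i V hi ih =>
      intro hV
      have hdisj : Disjoint {i} V := disjoint_singleton_left.2 hi
      have h1 := h.coalition_prob_add hodd hA hb hdisj hV
      have h2 := hcompl _ hV
      rw [card_insert_of_notMem hi] at hV
      rw [sum_insert hi, ← ih (by omega)]
      rw [insert_eq] at h2 ⊢
      linarith
  refine ⟨fun i => b {i}, fun i => ?_, fun R hR x y V hxy h1 h2 => ⟨fun hV => ?_, fun hV => ?_⟩⟩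
  · refine (h.nonneg (hP {i}) x₀).trans_eq (hbP _)
  · rw [hb R hR x y V hxy h1 h2, hsum V hV]
  · have hV' : 2 * #Vᶜ < n := by
      rw [card_compl, Fintype.card_fin]
      omega
    have := hcompl _ hV'
    rw [compl_compl] at this
    rw [hb R hR x y V hxy h1 h2, ← hsum _ hV']
    linarith

lemma topWeight_le (h : ContourRule D f) (hodd : Odd n) {γ : Fin n → ℝ}
    (hγ : HasWeights D f γ) {R : Prof n A} (hR : R ∈ D) {x z : A} (hz : z ≠ x)
    (hmaj : Majority (fun i => z ∈ UC (R i) x)) : topWeight γ R x ≤ f R x := by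
  let V : Finset (Fin n) := {i | TopRanked (R i) x}
  have hV : ∀ i ∈ V, UC (R i) x = {x} := fun i hi =>
    ((h.isProf R hR i).UC_eq_singleton_iff).2 (by simpa [V] using hi)
  have hQ := h.condorcet (coalitionProf_mem hodd hz.symm V)
  have hcard : 2 * #V < n := by
    have h1 : Majority (fun i => i ∉ V) := hmaj.mono fun i hi hiV => by
      rw [hV i hiV] at hi
      exact hz hi
    have h2 : ¬ Majority (fun i => i ∈ V) := fun hm => hm.not_not h1
    rw [majority_mem_iff] at h2
    obtain ⟨k, hk⟩ := hodd
    omega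
  rw [topWeight_eq_sum_filter, ← (hγ _ hQ x z V hz.symm (fun i hi => UC_coalitionProf_of_mem hi)
    (fun i hi => by rw [UC_coalitionProf_of_notMem hi]; trivial)).1 hcard]
  refine h.mono hQ hR z (fun i => ?_) (Or.inl ⟨hz, hmaj⟩)
  by_cases hi : i ∈ V
  · rw [UC_coalitionProf_of_mem hi]
    exact (hV i hi).subset
  · rw [UC_coalitionProf_of_notMem hi]
    exact Set.subset_univ _

lemma topWeight_add_le (h : ContourRule D f) (hodd : Odd n) {γ : Fin n → ℝ}
    (hγ : HasWeights D f γ) {R : Prof n A} (hR : R ∈ D) {x y : A} (hxy : x ≠ y)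
    (hmaj : Majority (fun i => TopRanked (R i) x)) :
    topWeight γ R x + (1 - ∑ i, γ i) ≤ f R x := by
  let V : Finset (Fin n) := {i | TopRanked (R i) x}
  have hV : ∀ i ∈ V, UC (R i) x = {x} := fun i hi =>
    ((h.isProf R hR i).UC_eq_singleton_iff).2 (by simpa [V] using hi)
  have hQ := h.condorcet (coalitionProf_mem hodd hxy V)
  have hval := (hγ _ hQ x y V hxy (fun i hi => UC_coalitionProf_of_mem hi)
    (fun i hi => by rw [UC_coalitionProf_of_notMem hi]; trivial)).2 hmaj
  have hle := h.mono hQ hR (x := x) x (fun i => ?_) (Or.inr fun w hw => hmaj.mono fun i hi => ?_)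
  · have := sum_add_sum_compl V γ
    have hV' : topWeight γ R x = ∑ i ∈ V, γ i := topWeight_eq_sum_filter γ R x
    linarith
  · by_cases hi : i ∈ V
    · rw [UC_coalitionProf_of_mem hi]
      exact (hV i hi).subset
    · rw [UC_coalitionProf_of_notMem hi]
      exact Set.subset_univ _
  · rw [UC_coalitionProf_of_mem (by simpa [V] using hi)]
    simpa using hw

lemma apply_eq_topWeight (h : ContourRule D f) (hodd : Odd n) {γ : Fin n → ℝ}
    (hγ : HasWeights D f γ) {R : Prof n A} (hR : R ∈ D) {x : A}
    (hx : ¬ CondorcetWinner R x) : f R x = topWeight γ R x := by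
  have : Nonempty A := ⟨x⟩
  have hRp := h.isProf R hR
  obtain ⟨z, hz, hmaj⟩ := exists_majority_above hodd hRp hx
  refine le_antisymm ?_ (h.topWeight_le hodd hγ hR hz hmaj)
  have hex : ∀ i, ∃ y ∈ UC (R i) x, (z ∈ UC (R i) x → y = z) ∧ (y = x → TopRanked (R i) x) := by
    intro i
    by_cases hzi : z ∈ UC (R i) x
    · exact ⟨z, hzi, fun _ => rfl, fun hzx => absurd hzx hz⟩
    · by_cases ht : TopRanked (R i) x
      · exact ⟨x, self_mem_UC _ _, fun h' => absurd h' hzi, fun _ => ht⟩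
      · rw [← (hRp i).UC_eq_singleton_iff] at ht
        by_contra! hcon
        refine ht (Set.Subset.antisymm (fun y hy => ?_) (by simpa using self_mem_UC _ _))
        exact (hcon y hy fun h' => absurd h' hzi).1
  choose y hyU hyz hyx using hex
  let U : Fin n → Set A := fun i => {x, y i}
  let Q : Prof n A := contourProf x z U fun _ => Set.univ
  have hUsub : ∀ i, U i ⊆ UC (R i) x := fun i =>
    Set.insert_subset (self_mem_UC _ _) (by simpa using hyU i)
  have hUQ : ∀ i, UC (Q i) x = U i := fun i => UC_contourKey (by simp [U])
  have hmajU : Majority (fun i => z ∈ U i) := hmaj.mono fun i hi => by simp [U, hyz i hi]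
  have hQ : Q ∈ D :=
    h.condorcet (contourProf_mem_of_majority hz (hmajU.mono fun i hi => ⟨hi, trivial⟩))
  have hQp := h.isProf Q hQ
  have htopz : ∀ i, z ∈ U i → TopRanked (Q i) z := fun i hi => by
    rw [← (hQp i).UC_eq_singleton_iff]
    simp only [Q, contourProf]
    rw [UC_contourKey_snd hz.symm, if_pos hi]
  have hmajQ : Majority (fun i => TopRanked (Q i) z) := hmajU.mono htopz
  have hle : ∀ a ∈ univ, topWeight γ Q a + (if a = z then 1 - ∑ i, γ i else 0) ≤ f Q a := by
    intro a _
    split_ifs with ha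
    · subst ha
      exact h.topWeight_add_le hodd hγ hQ hz hmajQ
    · rw [add_zero]
      refine h.topWeight_le hodd hγ hQ (Ne.symm ha) (hmajQ.mono fun i hi => ?_)
      exact Or.inl (hi a ha)
  have heq := (sum_eq_sum_iff_of_le hle).1 (by
    rw [h.sum_eq_one hQ, sum_add_distrib, sum_topWeight γ hQp]
    simp) x (mem_univ x)
  rw [if_neg hz.symm, add_zero] at heq
  have hRQ : topWeight γ Q x = topWeight γ R x := by
    have : ∀ i, TopRanked (Q i) x ↔ TopRanked (R i) x := fun i => by
      rw [← (hQp i).UC_eq_singleton_iff, ← (hRp i).UC_eq_singleton_iff, hUQ]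
      constructor
      · intro hi
        have hyi : y i = x := by
          have : y i ∈ U i := by simp [U]
          rw [hi] at this
          exact this
        exact (hRp i).UC_eq_singleton_iff.2 (hyx i hyi)
      · intro hi
        have := hyU i
        rw [hi] at this
        have : y i = x := this
        simp [U, this]
    simp [topWeight_eq_sum_filter, this]
  rw [← hRQ, heq]
  refine h.mono hR hQ z (fun i => (hUQ i).trans_subset (hUsub i)) (Or.inl ⟨hz, ?_⟩)
  simpa only [hUQ] using hmajU

theorem exists_randomDictatorship (h : ContourRule D f) (hn : 3 ≤ n) (hodd : Odd n)
    (hA : 3 ≤ Fintype.card A) (hD : CondorcetDomain n A ⊂ D) :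
    ∃ γ : Fin n → ℝ, (∀ i, 0 ≤ γ i) ∧ ∑ i, γ i = 1 ∧
      ∀ R ∈ D, ∀ x, f R x = ∑ i, γ i * dict i R x := by
  obtain ⟨γ, hγ0, hγ⟩ := h.exists_weights hn hodd hA
  have hne : Nonempty A := Fintype.card_pos_iff.1 (by omega)
  have hsum : ∑ i, γ i = 1 := by
    obtain ⟨R, hR, hRC⟩ := Set.exists_of_ssubset hD
    have hRp := h.isProf R hR
    rw [← sum_topWeight γ hRp, ← h.sum_eq_one hR]
    refine sum_congr rfl fun x _ => ?_
    exact (h.apply_eq_topWeight hodd hγ hR fun hx => hRC ⟨hRp, x, hx⟩).symm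
  refine ⟨γ, hγ0, hsum, fun R hR x => ?_⟩
  have hRp := h.isProf R hR
  change f R x = topWeight γ R x
  by_cases hx : CondorcetWinner R x
  · have hothers : ∑ a ∈ univ.erase x, f R a = ∑ a ∈ univ.erase x, topWeight γ R a := by
      refine sum_congr rfl fun a ha => h.apply_eq_topWeight hodd hγ hR fun hca => ?_
      have hax := ne_of_mem_erase ha
      have h1 := hx a hax
      have h2 := hca x hax.symm
      simp only [margin] at h1 h2
      omega
    have h1 := add_sum_erase univ (f R) (mem_univ x)
    have h2 := add_sum_erase univ (topWeight γ R) (mem_univ x)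
    rw [sum_topWeight γ hRp, hsum, ← hothers] at h2
    rw [h.sum_eq_one hR] at h1
    linarith
  · exact h.apply_eq_topWeight hodd hγ hR hx

end ContourRule

lemma strategyproof_of_randomDictatorship [Nonempty A] {D : Set (Prof n A)}
    (hD : ∀ R ∈ D, IsProf R) {f : Prof n A → A → ℝ} {γ : Fin n → ℝ} (hγ : ∀ i, 0 ≤ γ i)
    (hf : ∀ R ∈ D, ∀ x, f R x = ∑ i, γ i * dict i R x) : Strategyproof D f := by
  intro R hR R' hR' i hj x
  have hmass : ∀ P ∈ D, ∀ S : Set A, mass (f P) S = ∑ j, γ j * mass (dict j P) S := by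
    intro P hP S
    simp only [mass, mul_sum]
    rw [sum_comm]
    refine sum_congr rfl fun y _ => ?_
    by_cases hy : y ∈ S <;> simp [hy, hf P hP]
  rw [hmass R hR, hmass R' hR']
  refine sum_le_sum fun j _ => mul_le_mul_of_nonneg_left ?_ (hγ j)
  by_cases hji : j = i
  · subst hji
    have hle : mass (dict j R') (UC (R j) x) ≤ 1 := by
      rw [← sum_dict (hD R' hR') j]
      refine sum_le_sum fun y _ => Set.indicator_le_self' (fun _ _ => ?_) y
      unfold dict
      split_ifs <;> norm_num
    refine hle.trans (le_of_eq ?_)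
    rw [← sum_dict (hD R hR) j]
    refine sum_congr rfl fun y _ => ?_
    by_cases hy : y ∈ UC (R j) x
    · rw [Set.indicator_of_mem hy]
    · have hyx : y ≠ x := fun he => hy (he ▸ self_mem_UC _ _)
      have : ¬ TopRanked (R j) y := fun ht => hy (Or.inl (ht x hyx.symm))
      rw [Set.indicator_of_notMem hy, dict, if_neg this]
  · have : dict j R' = dict j R := by
      ext y
      simp only [dict, hj j hji]
    rw [this]

lemma nonImposing_of_randomDictatorship (hn : 0 < n) {D : Set (Prof n A)}
    (hD : CondorcetDomain n A ⊆ D) {f : Prof n A → A → ℝ} {γ : Fin n → ℝ} (hγ : ∑ i, γ i = 1)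
    (hf : ∀ R ∈ D, ∀ x, f R x = ∑ i, γ i * dict i R x) : NonImposing D f := by
  intro x
  let R : Prof n A := contourProf x x (fun _ => {x}) (fun _ => Set.univ)
  have hR : R ∈ D := hD (contourProf_mem_of_beats fun y hy => by simp [Majority, hy, hn])
  refine ⟨R, hR, ?_⟩
  have htop : ∀ i, TopRanked (R i) x := fun i => by
    rw [← (isProf_contourProf _ _ _ _ i).UC_eq_singleton_iff, contourProf, UC_contourKey (Set.mem_singleton x)]
  rw [hf R hR, ← hγ]
  simp [dict, htop]

end RandomDictatorship

/-- For odd `n ≥ 3` and a connected domain `D ⊋ D_C`, an SDS on `D` is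
strategyproof and non-imposing iff it is a random dictatorship. -/
theorem sds_superCondorcet_random_dictatorship {n : ℕ} {A : Type*} [Fintype A]
    (hn : 3 ≤ n) (hodd : Odd n) (hA : 3 ≤ Fintype.card A)
    (D : Set (Prof n A)) (hDprof : ∀ R ∈ D, IsProf R)
    (hDC : CondorcetDomain n A ⊂ D) (hconn : Connected D)
    (f : Prof n A → A → ℝ) (hf : IsSDS D f) :
    (Strategyproof D f ∧ NonImposing D f) ↔
      (∃ γ : Fin n → ℝ, (∀ i, 0 ≤ γ i) ∧ ∑ i, γ i = 1 ∧
        ∀ R ∈ D, ∀ x, f R x = ∑ i, γ i * dict i R x) := by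
  constructor
  · rintro ⟨hsp, hni⟩
    exact ContourRule.exists_randomDictatorship
      ⟨hDprof, hDC.subset, hf, hsp, hni, hsp.contour hDprof hconn⟩ hn hodd hA hDC
  · rintro ⟨γ, hγ, hsum, hfγ⟩
    have : Nonempty A := Fintype.card_pos_iff.1 (by omega)
    exact ⟨strategyproof_of_randomDictatorship hDprof hγ hfγ,
      nonImposing_of_randomDictatorship (by omega) hDC.subset hsum hfγ⟩
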